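/- arXiv:1108.6088 — 6 statements merged into one kernel-verified Lean document; each statement's English description precedes it below -/
import Mathlib

section
/- Let N, M ≥ 1 and let L be a real N×M loss matrix; for each action i ∈ {1,…,N} define the affine loss function f_i(q) = ∑_{j=1}^M L_{i,j} q_j on the standard simplex Δ_M. Assume no action is completely dominated, i.e., for every i there exists s ∈ Δ_M with f_i(s) < f_k(s) for all k ≠ i. Let q ∈ Δ_M and let i₁ ≠ i₂ be such that f_{i₁}(q) ≤ f_k(q) for all k (i₁ is a best response at q) and f_{i₂}(q) ≤ f_k(q) for all k ≠ i₁ (i₂ is a second-best response at q). Then there exists p ∈ Δ_M with f_{i₁}(p) = f_{i₂}(p) and f_{i₁}(p) ≤ f_k(p) for all k; that is, the best-response cells of i₁ and i₂ intersect (i₁ and i₂ are neighboring actions). -/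
/-- Any best response `i₁` and any second-best response `i₂` to the same mixed strategy
`q` are neighbors: their best-response cells intersect, provided no action is completely
dominated by the others. -/
theorem best_and_second_best_are_neighbors
    (N M : ℕ) (hN : 1 ≤ N) (hM : 1 ≤ M)
    (L : Matrix (Fin N) (Fin M) ℝ)
    (f : Fin N → (Fin M → ℝ) → ℝ)
    (hf : ∀ i q, f i q = ∑ j, L i j * q j)
    (hnodom : ∀ i : Fin N, ∃ s ∈ stdSimplex ℝ (Fin M), ∀ k, k ≠ i → f i s < f k s)
    (q : Fin M → ℝ) (hq : q ∈ stdSimplex ℝ (Fin M))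
    (i₁ i₂ : Fin N) (hne : i₁ ≠ i₂)
    (hbest : ∀ k, f i₁ q ≤ f k q)
    (hsecond : ∀ k, k ≠ i₁ → f i₂ q ≤ f k q) :
    ∃ p ∈ stdSimplex ℝ (Fin M), f i₁ p = f i₂ p ∧ ∀ k, f i₁ p ≤ f k p := by

  obtain ⟨s, hs, hs2⟩ := hnodom i₂
  have hb : 0 < f i₁ s - f i₂ s := sub_pos.2 (hs2 i₁ hne)
  have ha : 0 ≤ f i₂ q - f i₁ q := sub_nonneg.2 (hbest i₂)
  have hlin : ∀ (k : Fin N) (x y : ℝ), f k (x • q + y • s) = x * f k q + y * f k s := by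
    intro k x y
    simp only [hf, Finset.mul_sum, ← Finset.sum_add_distrib, Pi.add_apply, Pi.smul_apply,
      smul_eq_mul]
    exact Finset.sum_congr rfl fun j _ => by ring
  generalize hA : f i₂ q - f i₁ q = a at ha
  generalize hB : f i₁ s - f i₂ s = b at hb
  have hab : 0 < a + b := by linarith
  have hx : 0 ≤ b / (a + b) := by positivity
  have hy : 0 ≤ a / (a + b) := by positivity
  have hxy : b / (a + b) + a / (a + b) = 1 := by field_simp; ring
  have heq : f i₁ ((b / (a + b)) • q + (a / (a + b)) • s)
      = f i₂ ((b / (a + b)) • q + (a / (a + b)) • s) := by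
    rw [hlin, hlin, show f i₂ q = f i₁ q + a by linarith, show f i₁ s = f i₂ s + b by linarith]
    ring
  refine ⟨_, convex_stdSimplex ℝ (Fin M) hq hs hx hy hxy, heq, fun k => ?_⟩
  by_cases hk : k = i₁
  · rw [hk]
  rw [heq, hlin, hlin]
  have h1 := hsecond k hk
  have h2 : f i₂ s ≤ f k s := by
    by_cases h : k = i₂
    · rw [h]
    · exact (hs2 k h).le
  exact add_le_add (mul_le_mul_of_nonneg_left h1 hx) (mul_le_mul_of_nonneg_left h2 hy)
end

section
/- Let N, M, a, b ≥ 1. Let S₁ ∈ ℝ^{a×M}, S₂ ∈ ℝ^{b×M}, v₁ ∈ ℝ^a, v₂ ∈ ℝ^b, and ℓ₁, ℓ₂ ∈ ℝ^M satisfy the local observability identity: for every m ∈ {1,…,M}, ℓ₂(m) − ℓ₁(m) = ∑_{r=1}^a v₁(r) S₁(r,m) + ∑_{r=1}^b v₂(r) S₂(r,m). Let p ∈ Δ_N and let q₁,…,q_N ∈ Δ_N satisfy the flow condition ∑_{k=1}^N p(k) q_k(i) = p(i) for every i. Fix actions i, j ∈ {1,…,N} with q_i(j) > 0 and an opponent action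 m ∈ {1,…,M}, and define for each pair (k, I) ∈ {1,…,N}² the estimate b(k,I) = 1[I = i]·(∑_r v₁(r) S₁(r,m)) + 1[k = i]·1[I = j]·(∑_r v₂(r) S₂(r,m))/q_i(j). Then the expectation of b under the two-level sampling scheme equals the scaled loss difference: ∑_{k=1}^N ∑_{I=1}^N p(k) q_k(I) b(k,I) = p(i)·(ℓ₂(m) − ℓ₁(m)). -/
/-- Single-round unbiasedness of the loss-difference estimate under the two-level sampling
scheme and the flow condition (Equation (2) of the paper). -/
theorem estimate_unbiased
    (N M a b : ℕ) (hN : 1 ≤ N) (hM : 1 ≤ M) (ha : 1 ≤ a) (hb : 1 ≤ b)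
    (S₁ : Matrix (Fin a) (Fin M) ℝ) (S₂ : Matrix (Fin b) (Fin M) ℝ)
    (v₁ : Fin a → ℝ) (v₂ : Fin b → ℝ)
    (ℓ₁ ℓ₂ : Fin M → ℝ)
    (hobs : ∀ m, ℓ₂ m - ℓ₁ m = (∑ r, v₁ r * S₁ r m) + (∑ r, v₂ r * S₂ r m))
    (p : Fin N → ℝ) (hp : p ∈ stdSimplex ℝ (Fin N))
    (q : Fin N → Fin N → ℝ) (hq : ∀ k, q k ∈ stdSimplex ℝ (Fin N))
    (hflow : ∀ i, ∑ k, p k * q k i = p i)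
    (i j : Fin N) (hqij : 0 < q i j)
    (m : Fin M)
    (est : Fin N → Fin N → ℝ)
    (hest : ∀ k I, est k I =
      (if I = i then ∑ r, v₁ r * S₁ r m else 0) +
      (if k = i ∧ I = j then (∑ r, v₂ r * S₂ r m) / q i j else 0)) :
    ∑ k, ∑ I, p k * q k I * est k I = p i * (ℓ₂ m - ℓ₁ m) := by
  rw [hobs m]
  generalize (∑ r, v₁ r * S₁ r m) = A at hest ⊢
  generalize (∑ r, v₂ r * S₂ r m) = B at hest ⊢
  have h1 : ∀ k, ∑ I, p k * q k I * est k I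
      = p k * q k i * A + (if k = i then p k * q k j * (B / q i j) else 0) := by
    intro k
    simp only [hest, mul_add, Finset.sum_add_distrib]
    congr 1
    · simp
    · by_cases hk : k = i <;> simp [hk]
  simp only [h1, Finset.sum_add_distrib, ← Finset.sum_mul, hflow]
  rw [Finset.sum_ite_eq' Finset.univ i, if_pos (Finset.mem_univ i)]
  have hne := hqij.ne'
  field_simp
end

section
/- Let N, M, a, b ≥ 1. Let Ξ₁ ∈ ℝ^{a×M} and Ξ₂ ∈ ℝ^{b×M} be matrices with nonnegative entries whose columns each sum to 1, let v₁ ∈ ℝ^a, v₂ ∈ ℝ^b, and ℓ₁, ℓ₂ ∈ ℝ^M satisfy: for every m ∈ {1,…,M}, ℓ₂(m) − ℓ₁(m) = ∑_{r=1}^a v₁(r) Ξ₁(r,m) + ∑_{r=1}^b v₂(r) Ξ₂(r,m). Let p ∈ Δ_N and q₁,…,q_N ∈ Δ_N satisfy ∑_{k=1}^N p(k) q_k(i) = p(i) for every i. Fix i, j ∈ {1,…,N} with q_i(j) > 0 and m ∈ {1,…,M}, and define for (k, I, σ₁, σ₂) ∈ {1,…,N}² × {1,…,a} × {1,…,b}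 the estimate b(k,I,σ₁,σ₂) = 1[I = i]·v₁(σ₁) + 1[k = i]·1[I = j]·v₂(σ₂)/q_i(j). Then ∑_{k,I,σ₁,σ₂} p(k) q_k(I) Ξ₁(σ₁,m) Ξ₂(σ₂,m) b(k,I,σ₁,σ₂) = p(i)·(ℓ₂(m) − ℓ₁(m)). -/
/-- Unbiasedness of the loss-difference estimate for partial monitoring with random signals
(Section 5 of the paper): the played pair `(k, I)` is drawn by the two-level scheme and the
random signals `σ₁, σ₂` are drawn independently from the columns of `Ξ₁, Ξ₂`. -/
theorem estimate_unbiased_random_signals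
    (N M a b : ℕ) (hN : 1 ≤ N) (hM : 1 ≤ M) (ha : 1 ≤ a) (hb : 1 ≤ b)
    (Ξ₁ : Matrix (Fin a) (Fin M) ℝ) (Ξ₂ : Matrix (Fin b) (Fin M) ℝ)
    (hΞ₁nonneg : ∀ r m, 0 ≤ Ξ₁ r m) (hΞ₁col : ∀ m, ∑ r, Ξ₁ r m = 1)
    (hΞ₂nonneg : ∀ r m, 0 ≤ Ξ₂ r m) (hΞ₂col : ∀ m, ∑ r, Ξ₂ r m = 1)
    (v₁ : Fin a → ℝ) (v₂ : Fin b → ℝ)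
    (ℓ₁ ℓ₂ : Fin M → ℝ)
    (hobs : ∀ m, ℓ₂ m - ℓ₁ m = (∑ r, v₁ r * Ξ₁ r m) + (∑ r, v₂ r * Ξ₂ r m))
    (p : Fin N → ℝ) (hp : p ∈ stdSimplex ℝ (Fin N))
    (q : Fin N → Fin N → ℝ) (hq : ∀ k, q k ∈ stdSimplex ℝ (Fin N))
    (hflow : ∀ i, ∑ k, p k * q k i = p i)
    (i j : Fin N) (hqij : 0 < q i j)
    (m : Fin M)
    (est : Fin N → Fin N → Fin a → Fin b → ℝ)
    (hest : ∀ k I σ₁ σ₂, est k I σ₁ σ₂ =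
      (if I = i then v₁ σ₁ else 0) +
      (if k = i ∧ I = j then v₂ σ₂ / q i j else 0)) :
    ∑ k, ∑ I, ∑ σ₁, ∑ σ₂,
        p k * q k I * Ξ₁ σ₁ m * Ξ₂ σ₂ m * est k I σ₁ σ₂
      = p i * (ℓ₂ m - ℓ₁ m) := by
  have key : ∀ c x y : ℝ, ∑ σ₁, ∑ σ₂, c * Ξ₁ σ₁ m * Ξ₂ σ₂ m * (x * v₁ σ₁ + y * v₂ σ₂)
      = c * x * (∑ r, v₁ r * Ξ₁ r m) + c * y * (∑ r, v₂ r * Ξ₂ r m) := by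
    intro c x y
    have h1 : ∀ σ₁, ∑ σ₂, c * Ξ₁ σ₁ m * Ξ₂ σ₂ m * (x * v₁ σ₁ + y * v₂ σ₂)
        = c * x * (v₁ σ₁ * Ξ₁ σ₁ m) + Ξ₁ σ₁ m * (c * y * (∑ r, v₂ r * Ξ₂ r m)) := by
      intro σ₁
      calc _ = ∑ σ₂, (c * x * (v₁ σ₁ * Ξ₁ σ₁ m) * Ξ₂ σ₂ m
              + Ξ₁ σ₁ m * (c * y) * (v₂ σ₂ * Ξ₂ σ₂ m)) :=
            Finset.sum_congr rfl fun _ _ => by ring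
        _ = _ := by
            rw [Finset.sum_add_distrib, ← Finset.mul_sum, ← Finset.mul_sum, hΞ₂col]
            ring
    rw [Finset.sum_congr rfl fun σ₁ _ => h1 σ₁, Finset.sum_add_distrib, ← Finset.mul_sum,
      ← Finset.sum_mul, hΞ₁col, one_mul]
  have h2 : ∀ k I, ∑ σ₁, ∑ σ₂, p k * q k I * Ξ₁ σ₁ m * Ξ₂ σ₂ m * est k I σ₁ σ₂
      = (if I = i then p k * q k I * (∑ r, v₁ r * Ξ₁ r m) else 0)
        + (if k = i then (if I = j then p k * q k I * (1 / q i j) * (∑ r, v₂ r * Ξ₂ r m) else 0)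
            else 0) := by
    intro k I
    have h3 := key (p k * q k I) (if I = i then 1 else 0) (if k = i ∧ I = j then 1 / q i j else 0)
    have h4 : ∀ σ₁ σ₂, est k I σ₁ σ₂ = (if I = i then 1 else 0) * v₁ σ₁
        + (if k = i ∧ I = j then 1 / q i j else 0) * v₂ σ₂ := by
      intro σ₁ σ₂
      rw [hest]
      split_ifs <;> ring
    simp only [h4]
    rw [h3, ← ite_and]
    split_ifs <;> ring
  simp only [h2, Finset.sum_add_distrib]
  rw [hobs, mul_add]
  congr 1
  · simp only [Finset.sum_ite_eq', Finset.mem_univ, if_true]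
    rw [← Finset.sum_mul, hflow]
  · rw [Finset.sum_comm]
    simp only [Finset.sum_ite_eq', Finset.mem_univ, if_true]
    field_simp
end

section
/- Let n ≥ 1, let x ∈ Δ_n, let 0 < γ ≤ 1/2, and define q(j) = (1−γ)·x(j) + γ/n. Let g : {1,…,n} → ℝ and let c : {1,…,n} → ℝ satisfy |c(j)| ≤ v for all j, where v ≥ 0. Then ∑_{j=1}^n q(j) · ( ∑_{i=1}^n x(i)·( g(i) + 1[i = j]·c(j)/q(j) )² ) ≤ 2·∑_{i=1}^n g(i)² + 4 n v². -/
/-- Per-round variance decomposition from Lemma 4: the expected squared local norm of the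
cost estimate `g + h`, where `h` is supported on the drawn coordinate `j` with value
`c j / q j`, is at most `2‖g‖² + 4nv²`. -/
theorem variance_decomposition_bound
    (n : ℕ) (hn : 1 ≤ n)
    (x : Fin n → ℝ) (hx : x ∈ stdSimplex ℝ (Fin n))
    (γ : ℝ) (hγ0 : 0 < γ) (hγ : γ ≤ 1 / 2)
    (q : Fin n → ℝ) (hq : ∀ j, q j = (1 - γ) * x j + γ / n)
    (g : Fin n → ℝ)
    (c : Fin n → ℝ) (v : ℝ) (hv : 0 ≤ v) (hc : ∀ j, |c j| ≤ v) :
    ∑ j, q j * (∑ i, x i * (g i + (if i = j then c j / q j else 0)) ^ 2)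
      ≤ 2 * ∑ i, g i ^ 2 + 4 * n * v ^ 2 := by
  obtain ⟨hx0, hx1⟩ := hx
  have hn' : (0 : ℝ) < n := by exact_mod_cast hn
  have hqpos : ∀ j, 0 < q j := by
    intro j
    rw [hq]
    have h1 : 0 ≤ (1 - γ) * x j := mul_nonneg (by linarith) (hx0 j)
    have h2 : 0 < γ / n := div_pos hγ0 hn'
    linarith
  have hxq : ∀ j, x j ≤ 2 * q j := by
    intro j
    rw [hq]
    have h2 : 0 < γ / n := div_pos hγ0 hn'
    nlinarith [hx0 j]
  have hqsum : ∑ j, q j = 1 := by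
    simp only [hq]
    rw [Finset.sum_add_distrib, ← Finset.mul_sum, hx1]
    simp only [Finset.sum_const, Finset.card_univ, Fintype.card_fin, nsmul_eq_mul]
    field_simp
    ring
  have hxle : ∀ i, x i ≤ 1 := by
    intro i
    rw [← hx1]
    exact Finset.single_le_sum (fun k _ => hx0 k) (Finset.mem_univ i)
  have hinner : ∀ j, ∑ i, x i * (g i + (if i = j then c j / q j else 0)) ^ 2
      ≤ 2 * ∑ i, g i ^ 2 + 2 * (x j * (c j / q j) ^ 2) := by
    intro j
    have h : ∀ i, x i * (g i + (if i = j then c j / q j else 0)) ^ 2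
        ≤ 2 * g i ^ 2 + (if i = j then 2 * (x j * (c j / q j) ^ 2) else 0) := by
      intro i
      have h1 : x i * g i ^ 2 ≤ g i ^ 2 :=
        mul_le_of_le_one_left (sq_nonneg _) (hxle i)
      split_ifs with hij
      · subst hij
        have h2 := mul_nonneg (hx0 i) (sq_nonneg (g i - c i / q i))
        linarith
      · have h2 := sq_nonneg (g i)
        rw [add_zero, add_zero]
        linarith
    calc _ ≤ ∑ i, (2 * g i ^ 2 + (if i = j then 2 * (x j * (c j / q j) ^ 2) else 0)) :=
          Finset.sum_le_sum fun i _ => h i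
      _ = _ := by
          rw [Finset.sum_add_distrib, ← Finset.mul_sum]
          simp
  have houter : ∀ j, q j * (∑ i, x i * (g i + (if i = j then c j / q j else 0)) ^ 2)
      ≤ q j * (2 * ∑ i, g i ^ 2) + 4 * v ^ 2 := by
    intro j
    have h1 := mul_le_mul_of_nonneg_left (hinner j) (hqpos j).le
    have hcv : c j ^ 2 ≤ v ^ 2 := sq_le_sq' (abs_le.mp (hc j)).1 (abs_le.mp (hc j)).2
    have h2 : q j * (x j * (c j / q j) ^ 2) = (x j / q j) * c j ^ 2 := by
      have := (hqpos j).ne'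
      field_simp
    have h3 : x j / q j ≤ 2 := (div_le_iff₀ (hqpos j)).mpr (hxq j)
    have h4 : (x j / q j) * c j ^ 2 ≤ 2 * v ^ 2 :=
      mul_le_mul h3 hcv (sq_nonneg _) (by norm_num)
    linarith
  calc _ ≤ ∑ j, (q j * (2 * ∑ i, g i ^ 2) + 4 * v ^ 2) :=
        Finset.sum_le_sum fun j _ => houter j
    _ = _ := by
        rw [Finset.sum_add_distrib, ← Finset.sum_mul, hqsum]
        simp only [Finset.sum_const, Finset.card_univ, Fintype.card_fin, nsmul_eq_mul]
        ring
end

section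
/- Let T ≥ 0 and v ≥ 0. Let z : {0,…,T−1} × ({0,…,T−1} → Bool) → ℝ be a predictable sequence: |z(t, b)| ≤ v for all t and b, and z(t, b) = z(t, b′) whenever b(s) = b′(s) for all s < t. For each Boolean vector b : {0,…,T−1} → Bool define G(b, ·) by the backward recursion G(b, T) = 0 and, for t < T, G(b, t) = z(t, b) + G(b, t+1) if b(t) = true, and G(b, t) = 0 if b(t) = false. Then the average over all 2^T Boolean vectors satisfies |2^{−T} · ∑_{b : {0,…,T−1} → Bool} G(b, 0)| ≤ 2v. -/
/-- Absolute first-moment bound, by induction on the number of coin flips. -/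
theorem sum_abs_accumulated_le (v : ℝ) (hv : 0 ≤ v) (T : ℕ) :
    ∀ (G : (Fin T → Bool) → ℕ → ℝ), (∀ b, G b T = 0) →
    (∀ (b : Fin T → Bool) (t : Fin T), b t = true → |G b t| ≤ v + |G b ((t : ℕ) + 1)|) →
    (∀ (b : Fin T → Bool) (t : Fin T), b t = false → G b t = 0) →
    ∑ b : Fin T → Bool, |G b 0| ≤ 2 ^ T * v := by
  induction T with
  | zero =>
    intro G h0 _ _
    simp [h0, hv]
  | succ T ih =>
    intro G h0 h1 h2
    have key := ih (fun b t => G (Fin.cons true b : Fin (T + 1) → Bool) (t + 1))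
      (fun b => h0 _)
      (fun b t ht => by
        have := h1 (Fin.cons true b) t.succ (by simpa using ht)
        simpa using this)
      (fun b t ht => by
        have := h2 (Fin.cons true b) t.succ (by simpa using ht)
        simpa using this)
    rw [← (Fin.consEquiv (fun _ : Fin (T + 1) => Bool)).sum_comp, Fintype.sum_prod_type,
      Fintype.sum_bool]
    have hf : ∀ b : Fin T → Bool, G (Fin.cons false b : Fin (T + 1) → Bool) 0 = 0 := fun b => by
      simpa using h2 (Fin.cons false b) 0 (by simp)
    have ht : ∀ b : Fin T → Bool, |G (Fin.cons true b : Fin (T + 1) → Bool) 0| ≤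
        v + |G (Fin.cons true b : Fin (T + 1) → Bool) (0 + 1)| := fun b => by
      simpa using h1 (Fin.cons true b) 0 (by simp)
    have hs := Finset.sum_le_sum (s := Finset.univ) (fun b _ => ht b)
    rw [Finset.sum_add_distrib] at hs
    change ∑ b : Fin T → Bool, |G (Fin.cons true b : Fin (T + 1) → Bool) 0| +
      ∑ b : Fin T → Bool, |G (Fin.cons false b : Fin (T + 1) → Bool) 0| ≤ _
    simp only [hf, abs_zero, Finset.sum_const_zero, add_zero]
    simp only [Finset.sum_const, Finset.card_univ, Fintype.card_pi, Fintype.card_bool,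
      Finset.prod_const, Fintype.card_fin, nsmul_eq_mul, Nat.cast_pow, Nat.cast_ofNat] at hs
    rw [pow_succ]
    linarith

/-- First-moment bound from Lemma 4 of the paper: the accumulated estimate, which grows by a
predictable bounded increment on each `true` coin flip and resets to `0` on a `false` flip,
has expectation (over the uniformly random Boolean vector of fair coin flips) at most `2v`
in absolute value. -/
theorem accumulated_estimate_first_moment
    (T : ℕ) (v : ℝ) (hv : 0 ≤ v)
    (z : Fin T → (Fin T → Bool) → ℝ)
    (hzbound : ∀ t b, |z t b| ≤ v)
    (hzpred : ∀ (t : Fin T) (b b' : Fin T → Bool),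
      (∀ s : Fin T, (s : ℕ) < (t : ℕ) → b s = b' s) → z t b = z t b')
    (G : (Fin T → Bool) → ℕ → ℝ)
    (hGT : ∀ b, G b T = 0)
    (hGtrue : ∀ (b : Fin T → Bool) (t : Fin T), b t = true →
      G b t = z t b + G b ((t : ℕ) + 1))
    (hGfalse : ∀ (b : Fin T → Bool) (t : Fin T), b t = false →
      G b t = 0) :
    |(2 ^ T : ℝ)⁻¹ * ∑ b : Fin T → Bool, G b 0| ≤ 2 * v := by
  have h := sum_abs_accumulated_le v hv T G hGT
    (fun b t ht => by
      rw [hGtrue b t ht]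
      exact (abs_add_le _ _).trans (by linarith [hzbound t b]))
    hGfalse
  have h' := (Finset.abs_sum_le_sum_abs (fun b => G b 0) Finset.univ).trans h
  have hp : (0 : ℝ) < 2 ^ T := by positivity
  rw [abs_mul, abs_of_pos (inv_pos.mpr hp), inv_mul_le_iff₀ hp]
  nlinarith [mul_nonneg hp.le hv]
end

section
/- Let T ≥ 0 and v ≥ 0. Let z : {0,…,T−1} × ({0,…,T−1} → Bool) → ℝ be a predictable sequence: |z(t, b)| ≤ v for all t and b, and z(t, b) = z(t, b′) whenever b(s) = b′(s) for all s < t. For each Boolean vector b : {0,…,T−1} → Bool define G(b, ·) by the backward recursion G(b, T) = 0 and, for t < T, G(b, t) = z(t, b) + G(b, t+1) if b(t) = true, and G(b, t) = 0 if b(t) = false. Then the average over all 2^T Boolean vectors satisfies 2^{−T} · ∑_{b : {0,…,T−1} → Bool} G(b, 0)² ≤ 10 v². -/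
/-- First and second moments of the accumulated estimate; predictability is not needed, since
the increments are bounded in absolute value. -/
theorem accumulated_aux (v : ℝ) (hv : 0 ≤ v) (T : ℕ) :
    ∀ (z : Fin T → (Fin T → Bool) → ℝ) (_ : ∀ t b, |z t b| ≤ v)
    (G : (Fin T → Bool) → ℕ → ℝ)
    (_ : ∀ b, G b T = 0)
    (_ : ∀ (b : Fin T → Bool) (t : Fin T), b t = true →
      G b t = z t b + G b ((t : ℕ) + 1))
    (_ : ∀ (b : Fin T → Bool) (t : Fin T), b t = false → G b t = 0),
    ∑ b : Fin T → Bool, |G b 0| ≤ 2 ^ T * v ∧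
    ∑ b : Fin T → Bool, (G b 0) ^ 2 ≤ 2 ^ T * (3 * v ^ 2) := by
  induction T with
  | zero =>
    intro z hz G h0 _ _
    simp only [h0]
    constructor
    · simpa using hv
    · simp
      positivity
  | succ T ih =>
    intro z hz G h0 ht hf
    have key : ∀ f : ℝ → ℝ, f 0 = 0 → ∑ b : Fin (T + 1) → Bool, f (G b 0) =
        ∑ b : Fin T → Bool, f (z 0 (Fin.cons true b) + G (Fin.cons true b) 1) := by
      intro f hf0
      rw [← (Fin.consEquiv (fun _ : Fin (T + 1) => Bool)).sum_comp, Fintype.sum_prod_type,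
        Fintype.sum_bool]
      have h1 : ∀ b : Fin T → Bool,
          G (Fin.cons true b : Fin (T + 1) → Bool) 0
            = z 0 (Fin.cons true b) + G (Fin.cons true b) 1 := by
        intro b
        simpa using ht (Fin.cons true b) 0 (by simp)
      have h2 : ∀ b : Fin T → Bool, G (Fin.cons false b : Fin (T + 1) → Bool) 0 = 0 := by
        intro b
        simpa using hf (Fin.cons false b) 0 (by simp)
      simp [Fin.consEquiv, h1, h2, hf0]
    obtain ⟨i1, i2⟩ := ih (fun t b => z t.succ (Fin.cons true b)) (fun t b => hz _ _)
      (fun b t => G (Fin.cons true b) (t + 1)) (fun b => h0 _)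
      (fun b t h => by simpa using ht (Fin.cons true b) t.succ (by simpa using h))
      (fun b t h => by simpa using hf (Fin.cons true b) t.succ (by simpa using h))
    simp only [zero_add] at i1 i2
    have hc : ∑ _b : Fin T → Bool, (1 : ℝ) = 2 ^ T := by simp
    constructor
    · rw [key (fun x => |x|) (by simp)]
      calc _ ≤ ∑ b : Fin T → Bool, (v * 1 + |G (Fin.cons true b) 1|) := by
            refine Finset.sum_le_sum fun b _ => (abs_add_le _ _).trans ?_
            linarith [hz 0 (Fin.cons true b)]
        _ ≤ _ := by
            rw [Finset.sum_add_distrib, ← Finset.mul_sum, hc, pow_succ (2 : ℝ) T]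
            linarith
    · rw [key (fun x => x ^ 2) (by simp)]
      calc _ ≤ ∑ b : Fin T → Bool, (v ^ 2 * 1 + 2 * v * |G (Fin.cons true b) 1|
              + (G (Fin.cons true b) 1) ^ 2) := by
            refine Finset.sum_le_sum fun b _ => ?_
            have h := (abs_add_le (z 0 (Fin.cons true b)) (G (Fin.cons true b) 1)).trans
              (add_le_add_left (hz 0 (Fin.cons true b)) _)
            have h' := pow_le_pow_left₀ (abs_nonneg _) h 2
            rw [sq_abs] at h'
            nlinarith [sq_abs (G (Fin.cons true b) 1)]
        _ ≤ _ := by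
            rw [Finset.sum_add_distrib, Finset.sum_add_distrib, ← Finset.mul_sum,
              ← Finset.mul_sum, hc, pow_succ (2 : ℝ) T]
            have := mul_le_mul_of_nonneg_left i1 (by positivity : 0 ≤ 2 * v)
            nlinarith

/-- Second-moment bound from Lemma 4 of the paper: the accumulated estimate, which grows by a
predictable bounded increment on each `true` coin flip and resets to `0` on a `false` flip,
has second moment (over the uniformly random Boolean vector of fair coin flips) at most
`10v²`. -/
theorem accumulated_estimate_second_moment
    (T : ℕ) (v : ℝ) (hv : 0 ≤ v)
    (z : Fin T → (Fin T → Bool) → ℝ)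
    (hzbound : ∀ t b, |z t b| ≤ v)
    (hzpred : ∀ (t : Fin T) (b b' : Fin T → Bool),
      (∀ s : Fin T, (s : ℕ) < (t : ℕ) → b s = b' s) → z t b = z t b')
    (G : (Fin T → Bool) → ℕ → ℝ)
    (hGT : ∀ b, G b T = 0)
    (hGtrue : ∀ (b : Fin T → Bool) (t : Fin T), b t = true →
      G b t = z t b + G b ((t : ℕ) + 1))
    (hGfalse : ∀ (b : Fin T → Bool) (t : Fin T), b t = false →
      G b t = 0) :
    (2 ^ T : ℝ)⁻¹ * ∑ b : Fin T → Bool, (G b 0) ^ 2 ≤ 10 * v ^ 2 := by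


  have h := (accumulated_aux v hv T z hzbound G hGT hGtrue hGfalse).2
  rw [inv_mul_le_iff₀ (by positivity)]
  refine h.trans (mul_le_mul_of_nonneg_left ?_ (by positivity))
  nlinarith [sq_nonneg v]
end
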